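/- Consider the Metropolis–Hastings algorithm with target π_d defined by dπ_d/dπ̃_d(x) = exp(−φ_d(x)), where π̃_d = N(A^{-1}b, A^{-1}), and stochastic AR(1) proposal y = Gx + g + ν. Suppose |φ_d(x)| ≤ M for all x ∈ ℝ^d. Let α(x,y) be the acceptance probability for target π_d, α̃(x,y) = min{1, e^Z} with Z = log(π̃_d(y)q(y,x)/(π̃_d(x)q(x,y))) be the acceptance probability for target π̃_d, and let E_{π_d}[α(x,y)] and E_{π̃_d}[α̃(x,y)] be the respective expected acceptance probabilities in equilibrium. Then e^{-3M} E_{π̃_d}[α̃(x,y)] ≤ E_{π_d}[α(x,y)] ≤ e^{3M} E_{π̃_d}[α̃(x,y)], and moreover E_{π_d}[α(x,y)] > 0 whenever E_{π̃_d}[|Z|] < ∞. -/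

import Mathlib

noncomputable section

open MeasureTheory Matrix Filter Topology

namespace AR1

/-- Density of the Gaussian distribution on `ℝ^d` with mean `m` and *precision* matrix `P`
(covariance `P⁻¹`). -/
def gaussDensity {d : ℕ} (m : Fin d → ℝ) (P : Matrix (Fin d) (Fin d) ℝ)
    (x : Fin d → ℝ) : ℝ :=
  Real.sqrt (P.det / (2 * Real.pi) ^ d) *
    Real.exp (-(1 / 2) * ((x - m) ⬝ᵥ (P *ᵥ (x - m))))

/-- Gaussian measure on `ℝ^d` with mean `m` and precision matrix `P`. -/
def gaussMeasure {d : ℕ} (m : Fin d → ℝ) (P : Matrix (Fin d) (Fin d) ℝ) :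
    Measure (Fin d → ℝ) :=
  volume.withDensity fun x => ENNReal.ofReal (gaussDensity m P x)

/-- Transition density of the stochastic AR(1) proposal `y = G x + g + ν`, `ν ~ N(0, S)`. -/
def propDensity {d : ℕ} (G : Matrix (Fin d) (Fin d) ℝ) (g : Fin d → ℝ)
    (S : Matrix (Fin d) (Fin d) ℝ) (x y : Fin d → ℝ) : ℝ :=
  gaussDensity (G *ᵥ x + g) S⁻¹ y

/-- Metropolis–Hastings acceptance probability for target density `tden` and proposal
transition density `qden`. -/
def accept {d : ℕ} (tden : (Fin d → ℝ) → ℝ) (qden : (Fin d → ℝ) → (Fin d → ℝ) → ℝ)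
    (x y : Fin d → ℝ) : ℝ :=
  min 1 (tden y * qden y x / (tden x * qden x y))

/-- Joint law of (current state, proposal) when the chain is in equilibrium. -/
def jointMeasure {d : ℕ} (tden : (Fin d → ℝ) → ℝ)
    (qden : (Fin d → ℝ) → (Fin d → ℝ) → ℝ) :
    Measure ((Fin d → ℝ) × (Fin d → ℝ)) :=
  volume.withDensity fun pr => ENNReal.ofReal (tden pr.1 * qden pr.1 pr.2)

/-- Expected Metropolis–Hastings acceptance probability in equilibrium. -/
def expAccept {d : ℕ} (tden : (Fin d → ℝ) → ℝ)
    (qden : (Fin d → ℝ) → (Fin d → ℝ) → ℝ) : ℝ :=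
  ∫ pr, accept tden qden pr.1 pr.2 ∂(jointMeasure tden qden)

/-- Expected squared jump size in direction `v`, in equilibrium:
`E[(vᵀ(x' - x))²]` where `x'` is the next state of the Metropolis–Hastings chain. -/
def expSqJump {d : ℕ} (tden : (Fin d → ℝ) → ℝ)
    (qden : (Fin d → ℝ) → (Fin d → ℝ) → ℝ) (v : Fin d → ℝ) : ℝ :=
  ∫ pr, (v ⬝ᵥ (pr.2 - pr.1)) ^ 2 * accept tden qden pr.1 pr.2 ∂(jointMeasure tden qden)

/-- `Z = log (π(y) q(y,x) / (π(x) q(x,y)))`. -/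
def logRatio {d : ℕ} (tden : (Fin d → ℝ) → ℝ)
    (qden : (Fin d → ℝ) → (Fin d → ℝ) → ℝ)
    (pr : (Fin d → ℝ) × (Fin d → ℝ)) : ℝ :=
  Real.log (tden pr.2 * qden pr.2 pr.1 / (tden pr.1 * qden pr.1 pr.2))

/-- Standard normal cumulative distribution function `Φ`. -/
def stdNormalCDF (z : ℝ) : ℝ :=
  (ProbabilityTheory.gaussianReal 0 1 (Set.Iic z)).toReal

/-- `Φ(μ/σ) + e^{μ + σ²/2} Φ(-σ - μ/σ)`. -/
def acceptLimit (μ σ : ℝ) : ℝ :=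
  stdNormalCDF (μ / σ) + Real.exp (μ + σ ^ 2 / 2) * stdNormalCDF (-σ - μ / σ)

/-- Normalized density of the target `π_d` with `dπ_d/dπ̃_d = exp(-φ)`,
`π̃_d = N(m, A⁻¹)` (precision `A`). -/
def ngDensity {d : ℕ} (φ : (Fin d → ℝ) → ℝ) (m : Fin d → ℝ)
    (A : Matrix (Fin d) (Fin d) ℝ) (x : Fin d → ℝ) : ℝ :=
  Real.exp (-(φ x)) * gaussDensity m A x /
    ∫ y, Real.exp (-(φ y)) * gaussDensity m A y

/-- Real power `A^s` of a symmetric positive definite matrix `A = Q diag(lam2) Qᵀ`. -/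
def apow {d : ℕ} (Q : Matrix (Fin d) (Fin d) ℝ) (lam2 : Fin d → ℝ) (s : ℝ) :
    Matrix (Fin d) (Fin d) ℝ :=
  Q * Matrix.diagonal (fun i => lam2 i ^ s) * Qᵀ

/-- The norm `|x|_s = |A^s x|` associated with `A = Q diag(lam2) Qᵀ`. -/
def anorm {d : ℕ} (Q : Matrix (Fin d) (Fin d) ℝ) (lam2 : Fin d → ℝ) (s : ℝ)
    (v : Fin d → ℝ) : ℝ :=
  Real.sqrt ((apow Q lam2 s *ᵥ v) ⬝ᵥ (apow Q lam2 s *ᵥ v))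

end AR1

namespace AR1

theorem gaussDensity_pos {d : ℕ} (m : Fin d → ℝ) {P : Matrix (Fin d) (Fin d) ℝ}
    (hP : P.PosDef) (x : Fin d → ℝ) : 0 < gaussDensity m P x := by
  have := hP.det_pos
  unfold gaussDensity
  positivity

theorem continuous_gaussDensity {d : ℕ} (P : Matrix (Fin d) (Fin d) ℝ) :
    Continuous fun p : (Fin d → ℝ) × (Fin d → ℝ) => gaussDensity p.1 P p.2 := by
  unfold gaussDensity
  fun_prop

theorem continuous_propDensity {d : ℕ} (G : Matrix (Fin d) (Fin d) ℝ) (g : Fin d → ℝ)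
    (S : Matrix (Fin d) (Fin d) ℝ) :
    Continuous fun p : (Fin d → ℝ) × (Fin d → ℝ) => propDensity G g S p.1 p.2 :=
  (continuous_gaussDensity S⁻¹).comp
    (f := fun p : (Fin d → ℝ) × (Fin d → ℝ) => (G *ᵥ p.1 + g, p.2)) (by fun_prop)

/-- The Gaussian density is normalized. -/
theorem integral_gaussDensity {d : ℕ} (m : Fin d → ℝ) {P : Matrix (Fin d) (Fin d) ℝ}
    (hP : P.PosDef) : ∫ x, gaussDensity m P x = 1 := by
  obtain ⟨B, hB⟩ : ∃ B : Matrix (Fin d) (Fin d) ℝ, P = Bᵀ * B := by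
    open scoped MatrixOrder in
    obtain ⟨B, hB⟩ := CStarAlgebra.nonneg_iff_eq_star_mul_self.mp hP.posSemidef.nonneg
    exact ⟨B, by rw [hB, star_eq_conjTranspose, conjTranspose_eq_transpose_of_trivial]⟩
  have hdet : P.det = B.det ^ 2 := by rw [hB, det_mul, det_transpose, sq]
  have hB0 : B.det ≠ 0 := by
    intro h
    have := hP.det_pos
    simp [hdet, h] at this
  let h : (Fin d → ℝ) → ℝ := fun x => ∏ i, Real.exp (-(1 / 2) * x i ^ 2)
  have hint : ∫ x, h x = Real.sqrt (2 * Real.pi) ^ d := by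
    simp only [h]
    rw [integral_fintype_prod_volume_eq_pow (fun t : ℝ => Real.exp (-(1 / 2) * t ^ 2)),
      integral_gaussian, Fintype.card_fin]
    congr 2
    ring
  have hquad (x : Fin d → ℝ) :
      Real.exp (-(1 / 2) * (x ⬝ᵥ (P *ᵥ x))) = h (toLin' B x) := by
    simp only [h, toLin'_apply, ← Real.exp_sum, ← Finset.mul_sum]
    rw [hB, ← mulVec_mulVec, dotProduct_mulVec, vecMul_transpose]
    simp [dotProduct, sq]
  have hcov : ∫ x, h (toLin' B x) = |B.det|⁻¹ * Real.sqrt (2 * Real.pi) ^ d := by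
    have hmeas : Measurable (toLin' B) :=
      (LinearMap.continuous_of_finiteDimensional _).measurable
    have hc : Continuous h := by fun_prop
    rw [← integral_map hmeas.aemeasurable hc.aestronglyMeasurable,
      Real.map_matrix_volume_pi_eq_smul_volume_pi hB0, integral_smul_measure, hint, abs_inv,
      ENNReal.toReal_ofReal (by positivity), smul_eq_mul]
  unfold gaussDensity
  rw [integral_const_mul,
    integral_sub_right_eq_self (fun x => Real.exp (-(1 / 2) * (x ⬝ᵥ (P *ᵥ x)))) m]
  simp_rw [hquad]
  have hsqrt : Real.sqrt ((2 * Real.pi) ^ d) = Real.sqrt (2 * Real.pi) ^ d := by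
    rw [Real.sqrt_eq_iff_mul_self_eq (by positivity) (by positivity), ← mul_pow,
      Real.mul_self_sqrt (by positivity)]
  rw [hcov, hdet, Real.sqrt_div (sq_nonneg _), Real.sqrt_sq_eq_abs, hsqrt]
  have : |B.det| ≠ 0 := abs_ne_zero.mpr hB0
  field_simp

theorem integrable_gaussDensity {d : ℕ} (m : Fin d → ℝ) {P : Matrix (Fin d) (Fin d) ℝ}
    (hP : P.PosDef) : Integrable (gaussDensity m P) := by
  by_contra h
  exact zero_ne_one ((integral_undef h).symm.trans (integral_gaussDensity m hP))

/-- In equilibrium, the mean acceptance probability is the integral of the symmetric function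
`min (π(x) q(x,y)) (π(y) q(y,x))`. -/
theorem expAccept_eq_integral_min {d : ℕ} {t : (Fin d → ℝ) → ℝ}
    {q : (Fin d → ℝ) → (Fin d → ℝ) → ℝ} (ht : ∀ x, 0 < t x) (hq : ∀ x y, 0 < q x y)
    (htm : Measurable t) (hqm : Measurable fun p : (Fin d → ℝ) × (Fin d → ℝ) => q p.1 p.2) :
    expAccept t q = ∫ p : (Fin d → ℝ) × (Fin d → ℝ),
      min (t p.1 * q p.1 p.2) (t p.2 * q p.2 p.1) := by
  have hm : Measurable fun p : (Fin d → ℝ) × (Fin d → ℝ) => t p.1 * q p.1 p.2 :=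
    (htm.comp measurable_fst).mul hqm
  unfold expAccept jointMeasure
  rw [integral_withDensity_eq_integral_toReal_smul₀ hm.ennreal_ofReal.aemeasurable (by simp)]
  congr 1 with p
  have h : 0 < t p.1 * q p.1 p.2 := mul_pos (ht _) (hq _ _)
  rw [ENNReal.toReal_ofReal h.le, smul_eq_mul, accept, mul_min_of_nonneg _ _ h.le, mul_one,
    mul_div_cancel₀ _ h.ne']

theorem integrable_target_mul_proposal {d : ℕ} {t : (Fin d → ℝ) → ℝ}
    {q : (Fin d → ℝ) → (Fin d → ℝ) → ℝ} (hq : ∀ x y, 0 ≤ q x y)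
    (ht : Integrable t) (htm : Measurable t)
    (hqm : Measurable fun p : (Fin d → ℝ) × (Fin d → ℝ) => q p.1 p.2)
    (hqi : ∀ x, Integrable (q x)) (hq1 : ∀ x, ∫ y, q x y = 1) :
    Integrable fun p : (Fin d → ℝ) × (Fin d → ℝ) => t p.1 * q p.1 p.2 := by
  have hm : Measurable fun p : (Fin d → ℝ) × (Fin d → ℝ) => t p.1 * q p.1 p.2 :=
    (htm.comp measurable_fst).mul hqm
  rw [Measure.volume_eq_prod, integrable_prod_iff hm.aestronglyMeasurable]
  refine ⟨Eventually.of_forall fun x => (hqi x).const_mul (t x), ?_⟩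
  simpa [integral_const_mul, abs_of_nonneg (hq _ _), hq1] using ht.abs

theorem integrable_min_flux {d : ℕ} {t : (Fin d → ℝ) → ℝ}
    {q : (Fin d → ℝ) → (Fin d → ℝ) → ℝ} (hq : ∀ x y, 0 ≤ q x y)
    (ht : Integrable t) (htm : Measurable t)
    (hqm : Measurable fun p : (Fin d → ℝ) × (Fin d → ℝ) => q p.1 p.2)
    (hqi : ∀ x, Integrable (q x)) (hq1 : ∀ x, ∫ y, q x y = 1) :
    Integrable fun p : (Fin d → ℝ) × (Fin d → ℝ) =>
      min (t p.1 * q p.1 p.2) (t p.2 * q p.2 p.1) := by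
  have h := integrable_target_mul_proposal hq ht htm hqm hqi hq1
  have hs : Integrable fun p : (Fin d → ℝ) × (Fin d → ℝ) => t p.2 * q p.2 p.1 := by
    rw [Measure.volume_eq_prod] at h ⊢
    exact h.swap
  exact h.inf hs

/-- A bounded perturbation `φ` of the potential changes the normalized density by a factor
between `exp (-2M)` and `exp (2M)`. -/
theorem ngDensity_mem_Icc {d : ℕ} (m : Fin d → ℝ) {A : Matrix (Fin d) (Fin d) ℝ}
    (hA : A.PosDef) {φ : (Fin d → ℝ) → ℝ} (hφm : Measurable φ) {M : ℝ}
    (hM : ∀ x, |φ x| ≤ M) (x : Fin d → ℝ) :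
    ngDensity φ m A x ∈ Set.Icc (Real.exp (-(2 * M)) * gaussDensity m A x)
      (Real.exp (2 * M) * gaussDensity m A x) := by
  have hp := gaussDensity_pos m hA
  have hpi := integrable_gaussDensity m hA
  have hlo (y) : Real.exp (-M) ≤ Real.exp (-(φ y)) :=
    Real.exp_le_exp.mpr (neg_le_neg (abs_le.mp (hM y)).2)
  have hhi (y) : Real.exp (-(φ y)) ≤ Real.exp M :=
    Real.exp_le_exp.mpr (neg_le.mp (abs_le.mp (hM y)).1)
  have hi : Integrable fun y => Real.exp (-(φ y)) * gaussDensity m A y :=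
    hpi.bdd_mul (c := Real.exp M) hφm.neg.exp.aestronglyMeasurable
      (Eventually.of_forall fun y => by
        rw [Real.norm_of_nonneg (Real.exp_pos _).le]; exact hhi y)
  have hZlo : Real.exp (-M) ≤ ∫ y, Real.exp (-(φ y)) * gaussDensity m A y := by
    calc Real.exp (-M) = ∫ y, Real.exp (-M) * gaussDensity m A y := by
          rw [integral_const_mul, integral_gaussDensity m hA, mul_one]
      _ ≤ _ := integral_mono (hpi.const_mul _) hi fun y =>
          mul_le_mul_of_nonneg_right (hlo y) (hp y).le
  have hZhi : ∫ y, Real.exp (-(φ y)) * gaussDensity m A y ≤ Real.exp M := by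
    calc _ ≤ ∫ y, Real.exp M * gaussDensity m A y := integral_mono hi (hpi.const_mul _) fun y =>
          mul_le_mul_of_nonneg_right (hhi y) (hp y).le
      _ = Real.exp M := by
          rw [integral_const_mul, integral_gaussDensity m hA, mul_one]
  have hZ : 0 < ∫ y, Real.exp (-(φ y)) * gaussDensity m A y := (Real.exp_pos _).trans_le hZlo
  have e1 : Real.exp (-(2 * M)) * Real.exp M = Real.exp (-M) := by rw [← Real.exp_add]; ring_nf
  have e2 : Real.exp (2 * M) * Real.exp (-M) = Real.exp M := by rw [← Real.exp_add]; ring_nf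
  constructor
  · rw [ngDensity, le_div_iff₀ hZ, mul_right_comm]
    refine mul_le_mul_of_nonneg_right (le_trans ?_ (hlo x)) (hp x).le
    exact (mul_le_mul_of_nonneg_left hZhi (Real.exp_pos _).le).trans_eq e1
  · rw [ngDensity, div_le_iff₀ hZ, mul_right_comm]
    refine mul_le_mul_of_nonneg_right ((hhi x).trans ?_) (hp x).le
    exact e2.symm.trans_le (mul_le_mul_of_nonneg_left hZlo (Real.exp_pos _).le)

/-- Mean acceptance probabilities are monotone under pointwise domination of the (not necessarily
normalized) target densities. -/
theorem expAccept_le_mul_expAccept {d : ℕ} {t u : (Fin d → ℝ) → ℝ}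
    {q : (Fin d → ℝ) → (Fin d → ℝ) → ℝ} (ht : ∀ x, 0 < t x) (hu : ∀ x, 0 < u x)
    (hq : ∀ x y, 0 < q x y) (hti : Integrable t) (hui : Integrable u)
    (htm : Measurable t) (hum : Measurable u)
    (hqm : Measurable fun p : (Fin d → ℝ) × (Fin d → ℝ) => q p.1 p.2)
    (hqi : ∀ x, Integrable (q x)) (hq1 : ∀ x, ∫ y, q x y = 1)
    {c : ℝ} (hc : 0 ≤ c) (htu : ∀ x, t x ≤ c * u x) :
    expAccept t q ≤ c * expAccept u q := by
  have hq0 (x y) := (hq x y).le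
  rw [expAccept_eq_integral_min ht hq htm hqm, expAccept_eq_integral_min hu hq hum hqm,
    ← integral_const_mul]
  refine integral_mono (integrable_min_flux hq0 hti htm hqm hqi hq1)
    ((integrable_min_flux hq0 hui hum hqm hqi hq1).const_mul c) fun p => ?_
  simp only [mul_min_of_nonneg _ _ hc, ← mul_assoc]
  exact min_le_min (mul_le_mul_of_nonneg_right (htu _) (hq0 _ _))
    (mul_le_mul_of_nonneg_right (htu _) (hq0 _ _))

theorem expAccept_pos {d : ℕ} {t : (Fin d → ℝ) → ℝ}
    {q : (Fin d → ℝ) → (Fin d → ℝ) → ℝ} (ht : ∀ x, 0 < t x) (hq : ∀ x y, 0 < q x y)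
    (hti : Integrable t) (htm : Measurable t)
    (hqm : Measurable fun p : (Fin d → ℝ) × (Fin d → ℝ) => q p.1 p.2)
    (hqi : ∀ x, Integrable (q x)) (hq1 : ∀ x, ∫ y, q x y = 1) :
    0 < expAccept t q := by
  have hpos (p : (Fin d → ℝ) × (Fin d → ℝ)) :
      0 < min (t p.1 * q p.1 p.2) (t p.2 * q p.2 p.1) :=
    lt_min (mul_pos (ht _) (hq _ _)) (mul_pos (ht _) (hq _ _))
  rw [expAccept_eq_integral_min ht hq htm hqm, integral_pos_iff_support_of_nonneg
    (fun p => (hpos p).le) (integrable_min_flux (fun x y => (hq x y).le) hti htm hqm hqi hq1),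
    Function.support_eq_univ fun p => (hpos p).ne']
  exact isOpen_univ.measure_pos _ Set.univ_nonempty

/-- For the MH algorithm with target `π_d` with
`dπ_d/dπ̃_d = exp(−φ_d)`, `π̃_d = N(A⁻¹b, A⁻¹)`, and stochastic AR(1) proposal, if
`|φ_d| ≤ M` then `e^{−3M} E_{π̃}[α̃] ≤ E_{π}[α] ≤ e^{3M} E_{π̃}[α̃]`, and
`E_{π}[α] > 0` whenever `E_{π̃}[|Z|] < ∞`. -/
theorem stmt_10 {d : ℕ} (A G S : Matrix (Fin d) (Fin d) ℝ) (b g : Fin d → ℝ)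
    (hA : A.PosDef) (hS : S.PosDef)
    (φ : (Fin d → ℝ) → ℝ) (hφm : Measurable φ)
    (M : ℝ) (hM : ∀ x, |φ x| ≤ M) :
    (Real.exp (-(3 * M)) *
        expAccept (gaussDensity (A⁻¹ *ᵥ b) A) (propDensity G g S) ≤
      expAccept (ngDensity φ (A⁻¹ *ᵥ b) A) (propDensity G g S) ∧
     expAccept (ngDensity φ (A⁻¹ *ᵥ b) A) (propDensity G g S) ≤
      Real.exp (3 * M) *
        expAccept (gaussDensity (A⁻¹ *ᵥ b) A) (propDensity G g S)) ∧
    (Integrable (logRatio (gaussDensity (A⁻¹ *ᵥ b) A) (propDensity G g S))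
        (jointMeasure (gaussDensity (A⁻¹ *ᵥ b) A) (propDensity G g S)) →
      0 < expAccept (ngDensity φ (A⁻¹ *ᵥ b) A) (propDensity G g S)) := by
  set m := A⁻¹ *ᵥ b
  have hM0 : 0 ≤ M := (abs_nonneg _).trans (hM 0)
  have hp := gaussDensity_pos m hA
  have hpi := integrable_gaussDensity m hA
  have hpm : Measurable (gaussDensity m A) :=
    ((continuous_gaussDensity A).comp (Continuous.prodMk_right m)).measurable
  have hq (x y) : 0 < propDensity G g S x y := gaussDensity_pos _ hS.inv y
  have hqi (x) : Integrable (propDensity G g S x) := integrable_gaussDensity _ hS.inv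
  have hq1 (x) : ∫ y, propDensity G g S x y = 1 := integral_gaussDensity _ hS.inv
  have hqm := (continuous_propDensity G g S).measurable
  have hn (x) := ngDensity_mem_Icc m hA hφm hM x
  have hn0 (x) : 0 < ngDensity φ m A x :=
    (mul_pos (Real.exp_pos _) (hp x)).trans_le (hn x).1
  have hnm : Measurable (ngDensity φ m A) := (hφm.neg.exp.mul hpm).div_const _
  have hni : Integrable (ngDensity φ m A) :=
    (hpi.const_mul (Real.exp (2 * M))).mono' hnm.aestronglyMeasurable
      (Eventually.of_forall fun x => by
        rw [Real.norm_of_nonneg (hn0 x).le]; exact (hn x).2)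
  have h23 : Real.exp (2 * M) ≤ Real.exp (3 * M) := Real.exp_le_exp.mpr (by linarith)
  refine ⟨⟨?_, ?_⟩, fun _ => expAccept_pos hn0 hq hni hnm hqm hqi hq1⟩
  · rw [Real.exp_neg, inv_mul_le_iff₀ (Real.exp_pos _)]
    refine expAccept_le_mul_expAccept hp hn0 hq hpi hni hpm hnm hqm hqi hq1
      (Real.exp_pos _).le fun x => ?_
    have h := (hn x).1
    rw [Real.exp_neg, inv_mul_le_iff₀ (Real.exp_pos _)] at h
    exact h.trans (mul_le_mul_of_nonneg_right h23 (hn0 x).le)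
  · exact expAccept_le_mul_expAccept hn0 hp hq hni hpi hnm hpm hqm hqi hq1
      (Real.exp_pos _).le fun x => (hn x).2.trans (mul_le_mul_of_nonneg_right h23 (hp x).le)

end AR1
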